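/- There exists a universal constant c > 0 such that, setting κ = ⌈2C⁴⌉, for all integers d, N ≥ 1, every matrix H ∈ ℝ^{N×N} with H Hᵀ = N·I_N whose entries are bounded in absolute value by C, and all words I, J over {1,…,d}, the Walsh–Hadamard random model satisfies ( E[ ( (1/N)⟨A_I h₀, A_J h₀⟩ − δ_{I,J} )² ] )^{1/2} ≤ (κ(|I|+|J|))!! · c/√N. -/

import Mathlib

open MeasureTheory ProbabilityTheory Matrix

noncomputable section

/-- Ordered product of the matrices `A i` along the word `I`
(the identity matrix for the empty word). -/
def wordProd {d : ℕ} {n : Type*} [Fintype n] [DecidableEq n]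
    (A : Fin d → Matrix n n ℝ) (I : List (Fin d)) : Matrix n n ℝ :=
  (I.map A).prod

/-- Kronecker delta of two words: `1` if `I = J`, `0` otherwise. -/
def wordDelta {d : ℕ} (I J : List (Fin d)) : ℝ := if I = J then 1 else 0

/-- Sample space of the Walsh–Hadamard random model: the diagonal vectors
`Δ^1, …, Δ^d ∈ ℝ^N` and the initial vector `h₀ ∈ ℝ^N`. -/
abbrev WHOmega (d N : ℕ) : Type :=
  (Fin d → Fin N → ℝ) × (Fin N → ℝ)

/-- The probability measure of the Walsh–Hadamard random model: all entries of the
vectors `Δ^i` are i.i.d. standard Gaussians, and the entries of `h₀` are i.i.d.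
standard Gaussians, independent of the `Δ^i`. -/
def whMeasure (d N : ℕ) : Measure (WHOmega d N) :=
  (Measure.pi fun _ : Fin d => Measure.pi fun _ : Fin N => gaussianReal 0 1).prod
    (Measure.pi fun _ : Fin N => gaussianReal 0 1)

/-- The channel matrices of the Walsh–Hadamard model: `A^i = (1/√N) H diag(Δ^i)`. -/
def whA {d N : ℕ} (H : Matrix (Fin N) (Fin N) ℝ) (ω : WHOmega d N) (i : Fin d) :
    Matrix (Fin N) (Fin N) ℝ :=
  (Real.sqrt N)⁻¹ • (H * Matrix.diagonal (ω.1 i))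

/-- The random feature `A_I h₀` associated to a word `I`. -/
def whFeature {d N : ℕ} (H : Matrix (Fin N) (Fin N) ℝ) (I : List (Fin d))
    (ω : WHOmega d N) : Fin N → ℝ :=
  (wordProd (whA H ω) I).mulVec ω.2

lemma integrable_pow_gaussianReal (n : ℕ) : Integrable (fun x : ℝ => x ^ n) (gaussianReal 0 1) := by
  have h := (memLp_id_gaussianReal (μ := 0) (v := 1) n).integrable_norm_pow'
  refine (integrable_norm_iff (by fun_prop)).1 ?_
  simpa [norm_pow] using h

lemma integral_pow_succ_succ_gaussianReal (n : ℕ) :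
    ∫ x : ℝ, x ^ (n + 2) ∂(gaussianReal 0 1) = (n + 1) * ∫ x : ℝ, x ^ n ∂(gaussianReal 0 1) := by
  have hint (k : ℕ) : Integrable (fun x : ℝ => x ^ k * gaussianPDFReal 0 1 x) := by
    have h := integrable_pow_gaussianReal k
    rw [gaussianReal_of_var_ne_zero _ one_ne_zero,
      integrable_withDensity_iff (by fun_prop) (by simp [gaussianPDF_lt_top])] at h
    simpa [toReal_gaussianPDF] using h
  have hd (x : ℝ) : HasDerivAt (gaussianPDFReal 0 1) (-x * gaussianPDFReal 0 1 x) x := by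
    have h1 : HasDerivAt (fun x : ℝ => -(x - 0) ^ 2 / (2 * ((1 : NNReal) : ℝ))) (-x) x := by
      have h := (((hasDerivAt_id' x).pow 2).neg.div_const 2)
      refine (h.congr_deriv (by simp; ring)).congr_of_eventuallyEq (.of_forall fun y => ?_)
      simp
    have h2 := h1.exp.const_mul ((Real.sqrt (2 * Real.pi * ((1 : NNReal) : ℝ)))⁻¹)
    refine h2.congr_deriv ?_
    simp only [gaussianPDFReal]; ring
  have key := integral_mul_deriv_eq_deriv_mul_of_integrable (A := ℝ)
    (u := fun x : ℝ => x ^ (n + 1)) (v := gaussianPDFReal 0 1)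
    (u' := fun x => (n + 1) * x ^ n) (v' := fun x => -x * gaussianPDFReal 0 1 x)
    (fun x _ => by simpa using hasDerivAt_pow (n + 1) x) (fun x _ => hd x)
    (by
      convert (hint (n + 2)).neg using 1
      ext x; simp; ring)
    (by
      convert (hint n).const_mul ((n : ℝ) + 1) using 1
      ext x; simp; ring)
    (hint (n + 1))
  simp only [integral_gaussianReal_eq_integral_smul one_ne_zero, smul_eq_mul]
  rw [← integral_const_mul]
  rw [← neg_inj, ← integral_neg, ← integral_neg]
  convert key using 1
  · congr 1; ext x; ring
  · rw [← integral_neg]; congr 1; ext x; ring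

lemma integrable_eval_gaussianReal (p : Polynomial ℝ) :
    Integrable (fun x => p.eval x) (gaussianReal 0 1) := by
  induction p using Polynomial.induction_on' with
  | add p q hp hq => simp only [Polynomial.eval_add]; exact hp.add hq
  | monomial n a => simpa using (integrable_pow_gaussianReal n).const_mul a

lemma integral_X_mul_gaussianReal (p : Polynomial ℝ) :
    ∫ x, (Polynomial.X * p).eval x ∂(gaussianReal 0 1)
      = ∫ x, (Polynomial.derivative p).eval x ∂(gaussianReal 0 1) := by
  induction p using Polynomial.induction_on' with
  | add p q hp hq =>
    simp only [mul_add, Polynomial.derivative_add, Polynomial.eval_add]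
    rw [integral_add, integral_add, hp, hq] <;> exact integrable_eval_gaussianReal _
  | monomial n a =>
    simp only [Polynomial.eval_mul, Polynomial.eval_X, Polynomial.eval_monomial,
      Polynomial.derivative_monomial]
    rcases n with _ | n
    · simp [integral_mul_const, integral_id_gaussianReal]
    · have h := integral_pow_succ_succ_gaussianReal n
      simp only [Nat.add_sub_cancel]
      rw [integral_const_mul, mul_assoc]
      push_cast
      rw [← h, ← integral_const_mul]
      congr 1; ext x; ring

lemma integral_pow_mul_pow_gaussianReal_nonneg (b : ℕ) : ∀ a : ℕ,
    0 ≤ ∫ x : ℝ, x ^ a * (x ^ 2 - 1) ^ b ∂(gaussianReal 0 1) := by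
  induction b using Nat.strong_induction_on with
  | _ b ih =>
  rcases b with _ | b
  · intro a
    induction a using Nat.strong_induction_on with
    | _ a iha =>
    match a with
    | 0 => simp
    | 1 => simp [integral_id_gaussianReal]
    | a + 2 =>
      have := iha a (by omega)
      simp only [pow_zero, mul_one] at this ⊢
      rw [integral_pow_succ_succ_gaussianReal]
      positivity
  · intro a
    have h := integral_X_mul_gaussianReal (Polynomial.X ^ (a + 1) * (Polynomial.X ^ 2 - 1) ^ b)
    have hi (a b : ℕ) : Integrable (fun x : ℝ => x ^ a * (x ^ 2 - 1) ^ b) (gaussianReal 0 1) := by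
      refine (integrable_eval_gaussianReal
        (Polynomial.X ^ a * (Polynomial.X ^ 2 - 1) ^ b)).congr (.of_forall fun x => ?_)
      simp
    have e : ∫ x : ℝ, x ^ a * (x ^ 2 - 1) ^ (b + 1) ∂(gaussianReal 0 1)
        = (a : ℝ) * ∫ x : ℝ, x ^ a * (x ^ 2 - 1) ^ b ∂(gaussianReal 0 1)
          + 2 * (b : ℝ) * ∫ x : ℝ, x ^ (a + 2) * (x ^ 2 - 1) ^ (b - 1) ∂(gaussianReal 0 1) := by
      have h1 : ∫ x : ℝ, x ^ a * (x ^ 2 - 1) ^ (b + 1) ∂(gaussianReal 0 1)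
          = ∫ x, (Polynomial.X * (Polynomial.X ^ (a + 1) * (Polynomial.X ^ 2 - 1) ^ b) : Polynomial ℝ).eval x
              ∂(gaussianReal 0 1) - ∫ x : ℝ, x ^ a * (x ^ 2 - 1) ^ b ∂(gaussianReal 0 1) := by
        rw [← integral_sub (integrable_eval_gaussianReal _) (hi _ _)]
        congr 1; ext x; simp; ring
      rw [h1, h]
      rw [← integral_const_mul, ← integral_const_mul,
        ← integral_sub (integrable_eval_gaussianReal _) (hi _ _),
        ← integral_add ((hi _ _).const_mul _) ((hi _ _).const_mul _)]
      congr 1; ext x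
      simp [Polynomial.derivative_pow]
      ring
    rw [e]
    have h1 := ih b (by omega) a
    have h2 : 0 ≤ 2 * (b : ℝ) * ∫ x : ℝ, x ^ (a + 2) * (x ^ 2 - 1) ^ (b - 1) ∂(gaussianReal 0 1) := by
      rcases b with _ | b
      · simp
      · have := ih b (by omega) (a + 2)
        simp only [Nat.add_sub_cancel]
        positivity
    positivity

lemma integral_pow_two_mul_gaussianReal_le (q : ℕ) :
    ∫ x : ℝ, x ^ (2 * q) ∂(gaussianReal 0 1) ≤ 2 ^ q * q.factorial := by
  induction q with
  | zero => simp
  | succ q ih =>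
    rw [show 2 * (q + 1) = 2 * q + 2 by ring, integral_pow_succ_succ_gaussianReal]
    have h0 : 0 ≤ ∫ x : ℝ, x ^ (2 * q) ∂(gaussianReal 0 1) := by
      simpa using integral_pow_mul_pow_gaussianReal_nonneg 0 (2 * q)
    rw [Nat.factorial_succ]
    push_cast
    calc _ ≤ (2 * (q : ℝ) + 2) * (2 ^ q * q.factorial) := by gcongr; linarith
      _ = _ := by ring

/-- A real random variable all of whose moments are finite. -/
def HasMoments {Ω : Type*} [MeasurableSpace Ω] (μ : Measure Ω) (f : Ω → ℝ) : Prop :=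
  ∀ p : ℕ, MemLp f p μ

namespace HasMoments

variable {Ω : Type*} [MeasurableSpace Ω] {μ : Measure Ω} {f g : Ω → ℝ}

lemma add (hf : HasMoments μ f) (hg : HasMoments μ g) : HasMoments μ (f + g) :=
  fun p => (hf p).add (hg p)

lemma sub (hf : HasMoments μ f) (hg : HasMoments μ g) : HasMoments μ (f - g) :=
  fun p => (hf p).sub (hg p)

lemma const [IsFiniteMeasure μ] (c : ℝ) : HasMoments μ (fun _ => c) :=
  fun _ => memLp_const c

lemma mul (hf : HasMoments μ f) (hg : HasMoments μ g) : HasMoments μ (f * g) := by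
  intro p
  have : ENNReal.HolderTriple ((2 * p : ℕ) : ENNReal) ((2 * p : ℕ) : ENNReal) (p : ENNReal) := by
    constructor
    push_cast
    rw [ENNReal.mul_inv (by simp) (by simp), ← add_mul, ENNReal.inv_two_add_inv_two, one_mul]
  exact (hg (2 * p)).mul (hf (2 * p))

lemma pow [IsFiniteMeasure μ] (hf : HasMoments μ f) (n : ℕ) : HasMoments μ (f ^ n) := by
  induction n with
  | zero => simpa using! const (μ := μ) 1
  | succ n ih => simpa [pow_succ] using ih.mul hf

lemma integrable (hf : HasMoments μ f) : Integrable f μ :=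
  memLp_one_iff_integrable.1 (by simpa using hf 1)

lemma integrable_pow [IsFiniteMeasure μ] (hf : HasMoments μ f) (n : ℕ) :
    Integrable (fun ω => f ω ^ n) μ :=
  (hf.pow n).integrable

end HasMoments

/-- A family of independent standard Gaussian random variables. -/
structure IsStdGaussianFamily {Ω κ : Type*} [MeasurableSpace Ω] (ξ : κ → Ω → ℝ)
    (μ : Measure Ω) : Prop where
  indep : iIndepFun ξ μ
  meas : ∀ k, Measurable (ξ k)
  law : ∀ k, μ.map (ξ k) = gaussianReal 0 1

/-- The semiring of functions generated by the nonnegative constants, the variables `ξ k` and the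
centred squares `(ξ k) ^ 2 - 1`. -/
def posCone {Ω κ : Type*} (ξ : κ → Ω → ℝ) : Subsemiring (Ω → ℝ) :=
  Subsemiring.closure ({f | ∃ c : ℝ, 0 ≤ c ∧ f = fun _ => c} ∪ {f | ∃ k, f = ξ k} ∪
    {f | ∃ k, f = ξ k ^ 2 - 1})

section Cone

variable {Ω κ : Type*} {ξ : κ → Ω → ℝ}

lemma const_mem_posCone {c : ℝ} (hc : 0 ≤ c) : (fun _ => c) ∈ posCone ξ :=
  Subsemiring.subset_closure (Or.inl (Or.inl ⟨c, hc, rfl⟩))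

lemma var_mem_posCone (k : κ) : ξ k ∈ posCone ξ :=
  Subsemiring.subset_closure (Or.inl (Or.inr ⟨k, rfl⟩))

lemma sq_sub_one_mem_posCone (k : κ) : ξ k ^ 2 - 1 ∈ posCone ξ :=
  Subsemiring.subset_closure (Or.inr ⟨k, rfl⟩)

variable [MeasurableSpace Ω] {μ : Measure Ω}

lemma IsStdGaussianFamily.integral_comp (h : IsStdGaussianFamily ξ μ) (k : κ) {f : ℝ → ℝ}
    (hf : Measurable f) : ∫ ω, f (ξ k ω) ∂μ = ∫ x, f x ∂(gaussianReal 0 1) := by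
  rw [← h.law k, integral_map (h.meas k).aemeasurable hf.aestronglyMeasurable]

lemma IsStdGaussianFamily.hasMoments (h : IsStdGaussianFamily ξ μ) (k : κ) :
    HasMoments μ (ξ k) := by
  intro p
  have := memLp_id_gaussianReal (μ := 0) (v := 1) p
  rw [← h.law k, memLp_map_measure_iff aestronglyMeasurable_id (h.meas k).aemeasurable] at this
  simpa using this

variable [IsProbabilityMeasure μ]

lemma IsStdGaussianFamily.hasMoments_of_mem (h : IsStdGaussianFamily ξ μ) {f : Ω → ℝ}
    (hf : f ∈ posCone ξ) : HasMoments μ f := by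
  induction hf using Subsemiring.closure_induction with
  | mem f hf =>
    rcases hf with (⟨c, -, rfl⟩ | ⟨k, rfl⟩) | ⟨k, rfl⟩
    · exact .const c
    · exact h.hasMoments k
    · exact ((h.hasMoments k).pow 2).sub (.const 1)
  | zero => exact .const 0
  | one => exact .const 1
  | add f g _ _ hf hg => exact hf.add hg
  | mul f g _ _ hf hg => exact hf.mul hg

lemma IsStdGaussianFamily.integral_nonneg [Fintype κ] (h : IsStdGaussianFamily ξ μ) {f : Ω → ℝ}
    (hf : f ∈ posCone ξ) : 0 ≤ ∫ ω, f ω ∂μ := by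
  classical
  have hf' := hf
  rw [posCone, Subsemiring.mem_closure_iff] at hf
  suffices H : f ∈ posCone ξ ∧ 0 ≤ ∫ ω, f ω ∂μ from H.2
  induction hf using AddSubmonoid.closure_induction with
  | zero => exact ⟨zero_mem _, by simp⟩
  | add f g _ _ hf hg =>
    have hf := hf (Subsemiring.mem_closure_iff.2 ‹_›)
    have hg := hg (Subsemiring.mem_closure_iff.2 ‹_›)
    refine ⟨add_mem hf.1 hg.1, ?_⟩
    simp only [Pi.add_apply]
    rw [integral_add (h.hasMoments_of_mem hf.1).integrable (h.hasMoments_of_mem hg.1).integrable]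
    exact add_nonneg hf.2 hg.2
  | mem f hf =>
    refine ⟨hf', ?_⟩
    obtain ⟨c, a, b, hc, rfl⟩ : ∃ (c : ℝ) (a b : κ → ℕ), 0 ≤ c ∧
        f = fun ω => c * ∏ k, ((ξ k ω) ^ a k * ((ξ k ω) ^ 2 - 1) ^ b k) := by
      clear hf'
      induction hf using Submonoid.closure_induction with
      | mem f hf =>
        rcases hf with (⟨c, hc, rfl⟩ | ⟨k, rfl⟩) | ⟨k, rfl⟩
        · exact ⟨c, 0, 0, hc, by simp⟩
        · refine ⟨1, Pi.single k 1, 0, zero_le_one, ?_⟩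
          ext ω
          simp [Pi.single_apply, Finset.prod_ite_eq', pow_ite]
        · refine ⟨1, 0, Pi.single k 1, zero_le_one, ?_⟩
          ext ω
          simp [Pi.single_apply, Finset.prod_ite_eq', pow_ite]
      | one => exact ⟨1, 0, 0, zero_le_one, by ext; simp⟩
      | mul f g _ _ hf hg =>
        obtain ⟨c, a, b, hc, rfl⟩ := hf
        obtain ⟨c', a', b', hc', rfl⟩ := hg
        refine ⟨c * c', a + a', b + b', mul_nonneg hc hc', ?_⟩
        ext ω
        simp only [Pi.mul_apply, Pi.add_apply, pow_add]
        rw [mul_mul_mul_comm, ← Finset.prod_mul_distrib]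
        congr 1
        exact Finset.prod_congr rfl fun k _ => by ring
    rw [integral_const_mul]
    refine mul_nonneg hc ?_
    rw [h.indep.integral_fun_prod_comp (f := fun k x => x ^ a k * (x ^ 2 - 1) ^ b k)
      (fun k => (h.meas k).aemeasurable)
      (fun k => Measurable.aestronglyMeasurable (by fun_prop))]
    refine Finset.prod_nonneg fun k _ => ?_
    rw [h.integral_comp k (f := fun x => x ^ a k * (x ^ 2 - 1) ^ b k) (by fun_prop)]
    exact integral_pow_mul_pow_gaussianReal_nonneg _ _

end Cone

/-- `f` is dominated by `g` in the order of the cone of positive combinations. -/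
def Dominated {Ω κ : Type*} (ξ : κ → Ω → ℝ) (f g : Ω → ℝ) : Prop :=
  g - f ∈ posCone ξ ∧ g + f ∈ posCone ξ

namespace Dominated

variable {Ω κ : Type*} {ξ : κ → Ω → ℝ} {f g f' g' : Ω → ℝ}

lemma of_mem (hf : f ∈ posCone ξ) : Dominated ξ f f :=
  ⟨by simp [zero_mem], add_mem hf hf⟩

lemma half_mem (hf : f + f ∈ posCone ξ) : f ∈ posCone ξ := by
  have := mul_mem (const_mem_posCone (ξ := ξ) (c := 1 / 2) (by norm_num)) hf
  convert this using 1
  ext ω; simp; ring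

lemma right_mem (h : Dominated ξ f g) : g ∈ posCone ξ := by
  refine half_mem ?_
  convert add_mem h.1 h.2 using 1
  ring

lemma mul (h : Dominated ξ f g) (h' : Dominated ξ f' g') : Dominated ξ (f * f') (g * g') := by
  refine ⟨half_mem ?_, half_mem ?_⟩
  · convert add_mem (mul_mem h.1 h'.2) (mul_mem h.2 h'.1) using 1; ring
  · convert add_mem (mul_mem h.1 h'.1) (mul_mem h.2 h'.2) using 1; ring

lemma const {c C : ℝ} (h : |c| ≤ C) : Dominated ξ (fun _ => c) (fun _ => C) :=
  ⟨const_mem_posCone (c := C - c) (by linarith [le_abs_self c]),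
    const_mem_posCone (c := C + c) (by linarith [neg_abs_le c])⟩

lemma sum {ι : Type*} (s : Finset ι) {f g : ι → Ω → ℝ} (h : ∀ i ∈ s, Dominated ξ (f i) (g i)) :
    Dominated ξ (∑ i ∈ s, f i) (∑ i ∈ s, g i) := by
  refine ⟨?_, ?_⟩
  · rw [← Finset.sum_sub_distrib]; exact sum_mem fun i hi => (h i hi).1
  · rw [← Finset.sum_add_distrib]; exact sum_mem fun i hi => (h i hi).2

variable [MeasurableSpace Ω] {μ : Measure Ω} [IsProbabilityMeasure μ]

lemma hasMoments (h : Dominated ξ f g) (hξ : IsStdGaussianFamily ξ μ) : HasMoments μ f := by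
  have := (hξ.hasMoments_of_mem h.right_mem).sub (hξ.hasMoments_of_mem h.1)
  simpa using this

lemma integral_sq_le [Fintype κ] (h : Dominated ξ f g) (hξ : IsStdGaussianFamily ξ μ) :
    ∫ ω, f ω ^ 2 ∂μ ≤ ∫ ω, g ω ^ 2 ∂μ := by
  have h1 := hξ.integral_nonneg (mul_mem h.1 h.2)
  have e : ∫ ω, ((g - f) * (g + f)) ω ∂μ = ∫ ω, g ω ^ 2 ∂μ - ∫ ω, f ω ^ 2 ∂μ := by
    rw [← integral_sub ((hξ.hasMoments_of_mem h.right_mem).integrable_pow 2)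
      ((h.hasMoments hξ).integrable_pow 2)]
    congr 1; ext ω; simp; ring
  linarith

end Dominated

/-- Moments of sums of independent centred variables with nonnegative moments. -/
lemma integral_sum_pow_le {Ω ι : Type*} [MeasurableSpace Ω] {μ : Measure Ω}
    [IsProbabilityMeasure μ] {Y : ι → Ω → ℝ} {K : ℝ} {Q : ℕ} (hK : 1 ≤ K)
    (hY : ∀ i, HasMoments μ (Y i))
    (hind : ∀ (s : Finset ι) (a : ι), a ∉ s → IndepFun (Y a) (∑ i ∈ s, Y i) μ)
    (hmean : ∀ i, ∫ ω, Y i ω ∂μ = 0)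
    (hpos' : ∀ (s : Finset ι) j, 0 ≤ ∫ ω, (∑ i ∈ s, Y i ω) ^ j ∂μ)
    (hle : ∀ i, ∀ j ≤ Q, ∫ ω, Y i ω ^ j ∂μ ≤ K) (q : ℕ) (hq : q ≤ Q) (s : Finset ι) :
    ∫ ω, (∑ i ∈ s, Y i ω) ^ q ∂μ ≤ (2 ^ Q * K) ^ q * (s.card : ℝ) ^ (q / 2) := by
  classical
  have hS (s : Finset ι) : HasMoments μ (fun ω => ∑ i ∈ s, Y i ω) := by
    intro p
    exact memLp_finsetSum s fun i _ => hY i p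
  have h2Q : (1 : ℝ) ≤ 2 ^ Q := one_le_pow₀ (by norm_num)
  have hb : 1 ≤ 2 ^ Q * K := one_le_mul_of_one_le_of_one_le h2Q hK
  set b : ℝ := 2 ^ Q * K with hbdef
  induction q using Nat.strong_induction_on generalizing s with
  | _ q ihq =>
  match q with
  | 0 => simp
  | 1 =>
    have : ∫ ω, (∑ i ∈ s, Y i ω) ∂μ = 0 := by
      rw [integral_finsetSum _ fun i _ => (hY i).integrable]
      exact Finset.sum_eq_zero fun i _ => hmean i
    simp only [pow_one, this]
    positivity
  | q + 2 =>
    induction s using Finset.induction_on with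
    | empty => simp
    | insert a s ha ihs =>
      set n : ℝ := (s.card : ℝ) with hn
      set h : ℕ := q / 2 with hh
      have hh2 : (q + 2) / 2 = h + 1 := by omega
      have hIY (j k : ℕ) : ∫ ω, Y a ω ^ j * (∑ i ∈ s, Y i ω) ^ k ∂μ
          = (∫ ω, Y a ω ^ j ∂μ) * ∫ ω, (∑ i ∈ s, Y i ω) ^ k ∂μ := by
        have h1 := (hind s a ha).comp (φ := fun x : ℝ => x ^ j) (ψ := fun x : ℝ => x ^ k)
          (by fun_prop) (by fun_prop)
        have h2 := h1.integral_fun_mul_eq_mul_integral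
          ((hY a).integrable_pow j).aestronglyMeasurable
          (by simpa [Function.comp_def] using! ((hS s).integrable_pow k).aestronglyMeasurable)
        simpa [Function.comp_def] using h2
      have hint (j k : ℕ) : Integrable (fun ω => Y a ω ^ j * (∑ i ∈ s, Y i ω) ^ k) μ :=
        (((hY a).pow j).mul ((hS s).pow k)).integrable
      have e : ∫ ω, (∑ i ∈ insert a s, Y i ω) ^ (q + 2) ∂μ
          = ∑ j ∈ Finset.range (q + 2), (∫ ω, Y a ω ^ (j + 1) ∂μ)
              * (∫ ω, (∑ i ∈ s, Y i ω) ^ (q + 1 - j) ∂μ) * ((q + 2).choose (j + 1) : ℝ)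
            + ∫ ω, (∑ i ∈ s, Y i ω) ^ (q + 2) ∂μ := by
        simp_rw [Finset.sum_insert ha, add_pow]
        rw [integral_finsetSum _ fun j _ => (hint j _).mul_const _]
        simp_rw [integral_mul_const, hIY]
        rw [Finset.sum_range_succ']
        congr 1
        · refine Finset.sum_congr rfl fun j hj => ?_
          congr 4
          ext ω
          congr 1
          omega
        · simp
      have hn0 : 0 ≤ n := by positivity
      have hterm : ∀ j ∈ Finset.range (q + 2), (∫ ω, Y a ω ^ (j + 1) ∂μ)
          * (∫ ω, (∑ i ∈ s, Y i ω) ^ (q + 1 - j) ∂μ) * ((q + 2).choose (j + 1) : ℝ)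
          ≤ K * (b ^ q * (n + 1) ^ h) * ((q + 2).choose (j + 1) : ℝ) := by
        intro j hj
        have hj := Finset.mem_range.1 hj
        refine mul_le_mul_of_nonneg_right ?_ (by positivity)
        rcases j with _ | j
        · simp only [zero_add, pow_one, hmean, zero_mul]
          positivity
        · refine mul_le_mul (hle a _ (by omega)) ?_ (hpos' s _) (by positivity)
          refine (ihq (q + 1 - (j + 1)) (by omega) (by omega) s).trans ?_
          refine mul_le_mul (pow_le_pow_right₀ hb (by omega)) ?_ (by positivity) (by positivity)
          calc (n : ℝ) ^ ((q + 1 - (j + 1)) / 2) ≤ (n + 1) ^ ((q + 1 - (j + 1)) / 2) := by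
                gcongr; linarith
            _ ≤ (n + 1) ^ h := pow_le_pow_right₀ (by linarith) (by omega)
      have hchoose : ∑ j ∈ Finset.range (q + 2), ((q + 2).choose (j + 1) : ℝ) ≤ 2 ^ Q := by
        have h1 := Nat.sum_range_choose (q + 2)
        rw [Finset.sum_range_succ'] at h1
        have h2 : ∑ j ∈ Finset.range (q + 2), (q + 2).choose (j + 1) ≤ 2 ^ Q :=
          (by omega : _ ≤ 2 ^ (q + 2)).trans (Nat.pow_le_pow_right (by norm_num) hq)
        exact_mod_cast h2
      have ihs' := ihs
      rw [e, Finset.card_insert_of_notMem ha, hh2]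
      rw [hh2] at ihs'
      push_cast
      rw [← hn]
      calc _ ≤ ∑ j ∈ Finset.range (q + 2), K * (b ^ q * (n + 1) ^ h) *
              ((q + 2).choose (j + 1) : ℝ) + b ^ (q + 2) * n ^ (h + 1) :=
            add_le_add (Finset.sum_le_sum hterm) ihs'
        _ = (b ^ q * (n + 1) ^ h) * (K * ∑ j ∈ Finset.range (q + 2),
              ((q + 2).choose (j + 1) : ℝ)) + b ^ (q + 2) * n ^ (h + 1) := by
            rw [← Finset.mul_sum]; ring
        _ ≤ (b ^ q * (n + 1) ^ h) * b ^ 2 + b ^ (q + 2) * ((n + 1) ^ h * n) := by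
            rw [pow_succ n h]
            have : K * ∑ j ∈ Finset.range (q + 2), ((q + 2).choose (j + 1) : ℝ) ≤ b ^ 2 := by
              calc _ ≤ K * 2 ^ Q := by gcongr
                _ = b := by rw [hbdef]; ring
                _ ≤ b ^ 2 := by nlinarith
            gcongr
            linarith
        _ = b ^ (q + 2) * (n + 1) ^ (h + 1) := by ring

/-- The law of a normalised sum of independent standard Gaussian variables. -/
lemma IsStdGaussianFamily.map_sum {Ω κ ι : Type*} [MeasurableSpace Ω] {μ : Measure Ω}
    [IsProbabilityMeasure μ] {ξ : κ → Ω → ℝ} (h : IsStdGaussianFamily ξ μ)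
    {e : ι → κ} (he : Function.Injective e) (s : Finset ι) :
    μ.map (∑ v ∈ s, ξ (e v)) = gaussianReal 0 s.card := by
  classical
  have hi : iIndepFun (fun v => ξ (e v)) μ := h.indep.precomp he
  induction s using Finset.induction_on with
  | empty =>
    simp only [Finset.sum_empty, Finset.card_empty, Nat.cast_zero, gaussianReal_zero_var]
    exact (Measure.map_const μ 0).trans (by simp)
  | insert a s ha ih =>
    rw [Finset.sum_insert ha]
    have h1 := (hi.indepFun_finsetSum_of_notMem (fun v => h.meas (e v)) ha).symm
    rw [gaussianReal_add_gaussianReal_of_indepFun h1 (h.law _) ih, Finset.card_insert_of_notMem ha]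
    simp [add_comm]

lemma IsStdGaussianFamily.integral_normalized_sum_pow {Ω κ : Type*} [MeasurableSpace Ω]
    {μ : Measure Ω} [IsProbabilityMeasure μ] {ξ : κ → Ω → ℝ} (h : IsStdGaussianFamily ξ μ)
    {N : ℕ} (hN : 1 ≤ N) {e : Fin N → κ} (he : Function.Injective e) (p : ℕ) :
    ∫ ω, ((Real.sqrt N)⁻¹ * ∑ v, ξ (e v) ω) ^ p ∂μ = ∫ x, x ^ p ∂(gaussianReal 0 1) := by
  have hm : Measurable (∑ v, ξ (e v)) := by
    convert Finset.measurable_sum Finset.univ fun v _ => h.meas (e v) using 1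
    ext ω; simp
  have h1 : (gaussianReal 0 ((Finset.univ : Finset (Fin N)).card : NNReal)).map
      (fun x => (Real.sqrt N)⁻¹ * x) = gaussianReal 0 1 := by
    rw [gaussianReal_map_const_mul]
    congr 1
    · simp
    · have : (N : ℝ) ≠ 0 := by positivity
      ext
      simp [Real.sq_sqrt, this]
  rw [← h1, ← h.map_sum he Finset.univ, Measure.map_map (by fun_prop) hm,
    integral_map ((by fun_prop : Measurable _).comp hm).aemeasurable
      (Measurable.aestronglyMeasurable (by fun_prop))]
  simp

lemma mul_mul_le_sum_cubes {x y z : ℝ} (hx : 0 ≤ x) (hy : 0 ≤ y) (hz : 0 ≤ z) :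
    x * y * z ≤ x ^ 3 + y ^ 3 + z ^ 3 := by
  have : 0 ≤ (x + y + z) * ((x - y) ^ 2 + (y - z) ^ 2 + (x - z) ^ 2) := by positivity
  have : 0 ≤ x ^ 3 := by positivity
  have : 0 ≤ y ^ 3 := by positivity
  have : 0 ≤ z ^ 3 := by positivity
  nlinarith

lemma List.prod_le_one_add_sum_pow (L : List ℝ) (hL : ∀ x ∈ L, 0 ≤ x) :
    L.prod ≤ 1 + (L.map (· ^ L.length)).sum := by
  have hnn : ∀ y ∈ L.map (· ^ L.length), 0 ≤ y := by
    intro y hy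
    obtain ⟨x, hx, rfl⟩ := List.mem_map.1 hy
    exact pow_nonneg (hL x hx) _
  rcases eq_or_ne L [] with rfl | hne
  · simp
  obtain ⟨M, hM, hmax⟩ : ∃ M ∈ L, ∀ x ∈ L, x ≤ M := by
    obtain ⟨M, hM, h⟩ := L.toFinset.exists_max_image id
      (by simpa [List.toFinset_nonempty_iff] using hne)
    exact ⟨M, by simpa using hM, fun x hx => h x (by simpa using hx)⟩
  have h1 : L.prod ≤ M ^ L.length := by
    clear hnn hM hne
    have hM0 : L = [] ∨ 0 ≤ M := by
      rcases L with _ | ⟨x, L⟩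
      · exact Or.inl rfl
      · exact Or.inr ((hL x (by simp)).trans (hmax x (by simp)))
    rcases hM0 with rfl | hM0
    · simp
    induction L with
    | nil => simp
    | cons x L ih =>
      rw [List.prod_cons, List.length_cons, pow_succ']
      refine mul_le_mul (hmax x (by simp))
        (ih (fun y hy => hL y (by simp [hy])) (fun y hy => hmax y (by simp [hy])))
        (List.prod_nonneg fun y hy => hL y (by simp [hy])) hM0
  have h2 : M ^ L.length ≤ (L.map (· ^ L.length)).sum :=
    List.single_le_sum hnn _ (List.mem_map.2 ⟨M, hM, rfl⟩)
  linarith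

section ProductBound

variable {Ω ι : Type*} [MeasurableSpace Ω] {μ : Measure Ω} [IsProbabilityMeasure μ]
  {T : ι → Ω → ℝ}

lemma HasMoments.list_prod (hT : ∀ i, HasMoments μ (T i)) (L : List ι) :
    HasMoments μ (fun ω => (L.map fun i => T i ω).prod) := by
  induction L with
  | nil => simpa using HasMoments.const (μ := μ) 1
  | cons i L ih => simpa using! (hT i).mul ih

lemma integral_list_sum_pow (hT : ∀ i, HasMoments μ (T i)) {p : ℕ} {c : ℝ}
    (hc : ∀ i, ∫ ω, T i ω ^ p ∂μ = c) (L : List ι) :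
    Integrable (fun ω => (L.map fun i => T i ω ^ p).sum) μ ∧
      ∫ ω, (L.map fun i => T i ω ^ p).sum ∂μ = L.length * c := by
  induction L with
  | nil => simp
  | cons i L ih =>
    simp only [List.map_cons, List.sum_cons, List.length_cons]
    refine ⟨((hT i).integrable_pow p).add ih.1, ?_⟩
    rw [integral_add ((hT i).integrable_pow p) ih.1, ih.2, hc i]
    push_cast; ring

lemma integral_list_prod_pow_four_le (hT : ∀ i, HasMoments μ (T i))
    (hg : ∀ i p, ∫ ω, T i ω ^ p ∂μ = ∫ x, x ^ p ∂(gaussianReal 0 1)) (L : List ι) :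
    ∫ ω, (L.map fun i => T i ω).prod ^ 4 ∂μ
      ≤ 1 + L.length * (16 ^ L.length * (L.length.factorial : ℝ) ^ 2) := by
  set m := L.length with hm
  have hi := integral_list_sum_pow hT (p := 2 * (2 * m)) (fun i => hg i _) L
  have hpt (ω : Ω) : (L.map fun i => T i ω).prod ^ 4
      ≤ 1 + (L.map fun i => T i ω ^ (2 * (2 * m))).sum := by
    have h := List.prod_le_one_add_sum_pow (L.map fun i => T i ω ^ 4) (by
      intro x hx
      obtain ⟨i, -, rfl⟩ := List.mem_map.1 hx
      positivity)
    rw [List.map_map, List.length_map, ← hm] at h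
    have e1 : (L.map fun i => T i ω).prod ^ 4 = (L.map fun i => T i ω ^ 4).prod := by
      have := map_list_prod (powMonoidHom 4 : ℝ →* ℝ) (L.map fun i => T i ω)
      simpa [List.map_map, Function.comp_def] using this
    have e2 : ((fun x : ℝ => x ^ m) ∘ fun i => T i ω ^ 4) = fun i => T i ω ^ (2 * (2 * m)) := by
      ext i
      simp only [Function.comp_apply, ← pow_mul]
      congr 1; ring
    rw [e1]
    rwa [e2] at h
  have hfac : ((2 * m).factorial : ℝ) ≤ 4 ^ m * (m.factorial : ℝ) ^ 2 := by
    have h1 := Nat.choose_mul_factorial_mul_factorial (n := 2 * m) (k := m) (by omega)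
    have h2 : (2 * m).choose m ≤ 4 ^ m := by
      calc _ ≤ 2 ^ (2 * m) := Nat.choose_le_two_pow _ _
        _ = 4 ^ m := by rw [pow_mul]; norm_num
    rw [show 2 * m - m = m by omega] at h1
    have : (2 * m).factorial ≤ 4 ^ m * m.factorial ^ 2 := by
      rw [← h1, mul_assoc, ← sq]
      exact Nat.mul_le_mul_right _ h2
    exact_mod_cast this
  calc _ ≤ ∫ ω, (1 + (L.map fun i => T i ω ^ (2 * (2 * m))).sum) ∂μ :=
        integral_mono ((HasMoments.list_prod hT L).integrable_pow 4)
          ((integrable_const _).add hi.1) hpt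
    _ = 1 + m * ∫ x, x ^ (2 * (2 * m)) ∂(gaussianReal 0 1) := by
        rw [integral_add (integrable_const _) hi.1, hi.2]; simp [← hm]
    _ ≤ 1 + m * (2 ^ (2 * m) * (4 ^ m * (m.factorial : ℝ) ^ 2)) := by
        gcongr
        refine (integral_pow_two_mul_gaussianReal_le (2 * m)).trans ?_
        gcongr
    _ = _ := by
        have : (16 : ℝ) ^ m = 2 ^ (2 * m) * 4 ^ m := by
          rw [pow_mul, ← mul_pow]; norm_num
        rw [this]; ring

lemma four_pow_le_factorial_sq (n : ℕ) : (4 : ℝ) ^ n ≤ 4 * (n.factorial : ℝ) ^ 2 := by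
  rcases n with _ | _ | n
  · norm_num
  · norm_num
  · induction n with
    | zero => norm_num [Nat.factorial]
    | succ n ih =>
      rw [pow_succ, Nat.factorial_succ]
      push_cast
      have : (4 : ℝ) ≤ (n + 1 + 1 + 1) ^ 2 := by nlinarith [(Nat.cast_nonneg n : (0 : ℝ) ≤ n)]
      calc _ ≤ 4 * ((n + 1 + 1).factorial : ℝ) ^ 2 * (n + 1 + 1 + 1) ^ 2 := by gcongr
        _ = _ := by ring

lemma integral_special_mul_list_prod_sq_le (hT : ∀ i, HasMoments μ (T i))
    (hg : ∀ i p, ∫ ω, T i ω ^ p ∂μ = ∫ x, x ^ p ∂(gaussianReal 0 1)) {K : ℝ}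
    {A B D : Ω → ℝ} (hA : HasMoments μ A) (hB : HasMoments μ B) (hD : HasMoments μ D)
    (hAK : ∫ ω, A ω ^ 12 ∂μ ≤ K) (hBK : ∫ ω, B ω ^ 12 ∂μ ≤ K) (hDK : ∫ ω, D ω ^ 12 ∂μ ≤ K)
    (L : List ι) {n : ℕ} (hL : L.length ≤ n) :
    ∫ ω, (A ω * B ω * D ω * (L.map fun i => T i ω).prod) ^ 2 ∂μ
      ≤ (12 * K + 2) * (2 ^ n * n.factorial) ^ 2 := by
  have hK : 0 ≤ K := (integral_nonneg fun ω => by positivity).trans hAK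
  have hG := HasMoments.list_prod hT L
  have hpt (ω : Ω) : (A ω * B ω * D ω * (L.map fun i => T i ω).prod) ^ 2
      ≤ 16 ^ n * (A ω ^ 12 + B ω ^ 12 + D ω ^ 12)
        + (16 ^ n)⁻¹ * (L.map fun i => T i ω).prod ^ 4 := by
    set G := (L.map fun i => T i ω).prod
    have h1 : (A ω * B ω * D ω) ^ 4 ≤ A ω ^ 12 + B ω ^ 12 + D ω ^ 12 := by
      calc _ = A ω ^ 4 * B ω ^ 4 * D ω ^ 4 := by ring
        _ ≤ (A ω ^ 4) ^ 3 + (B ω ^ 4) ^ 3 + (D ω ^ 4) ^ 3 :=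
            mul_mul_le_sum_cubes (by positivity) (by positivity) (by positivity)
        _ = _ := by ring
    set F := A ω * B ω * D ω
    have ht : (0 : ℝ) < 16 ^ n := by positivity
    have h2 : (F * G) ^ 2 ≤ 16 ^ n * F ^ 4 + (16 ^ n)⁻¹ * G ^ 4 := by
      set t : ℝ := 16 ^ n
      have h3 : 0 ≤ t⁻¹ * (t * F ^ 2 - G ^ 2) ^ 2 + (F * G) ^ 2 := by positivity
      have h4 : t⁻¹ * (t * F ^ 2 - G ^ 2) ^ 2
          = t * F ^ 4 + t⁻¹ * G ^ 4 - 2 * (F * G) ^ 2 := by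
        field_simp; ring
      linarith
    have h5 : (16 : ℝ) ^ n * F ^ 4 ≤ 16 ^ n * (A ω ^ 12 + B ω ^ 12 + D ω ^ 12) := by gcongr
    linarith
  have hi1 : Integrable (fun ω => (16 : ℝ) ^ n * (A ω ^ 12 + B ω ^ 12 + D ω ^ 12)) μ :=
    (((hA.integrable_pow 12).add (hB.integrable_pow 12)).add (hD.integrable_pow 12)).const_mul _
  have hi2 : Integrable (fun ω => ((16 : ℝ) ^ n)⁻¹ * (L.map fun i => T i ω).prod ^ 4) μ :=
    (hG.integrable_pow 4).const_mul _
  have hi12 : Integrable (fun ω => A ω ^ 12 + B ω ^ 12) μ :=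
    (hA.integrable_pow 12).add (hB.integrable_pow 12)
  have h16 : (16 : ℝ) ^ n = 4 ^ n * 4 ^ n := by rw [← mul_pow]; norm_num
  have hsq : ((2 : ℝ) ^ n * n.factorial) ^ 2 = 4 ^ n * (n.factorial : ℝ) ^ 2 := by
    rw [mul_pow, ← pow_mul, mul_comm n 2, pow_mul]; norm_num
  have hG4 : ((16 : ℝ) ^ n)⁻¹ * ∫ ω, (L.map fun i => T i ω).prod ^ 4 ∂μ
      ≤ 2 * (2 ^ n * n.factorial) ^ 2 := by
    have h1 : ∫ ω, (L.map fun i => T i ω).prod ^ 4 ∂μ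
        ≤ 1 + n * (16 ^ n * (n.factorial : ℝ) ^ 2) := by
      refine (integral_list_prod_pow_four_le hT hg L).trans ?_
      gcongr
      norm_num
    have hf1 : (1 : ℝ) ≤ n.factorial := by exact_mod_cast n.factorial_pos
    have hn4 : (n : ℝ) ≤ 4 ^ n := by exact_mod_cast (Nat.lt_pow_self (by norm_num)).le
    have hone : (1 : ℝ) ≤ 16 ^ n := one_le_pow₀ (by norm_num)
    rw [hsq, inv_mul_le_iff₀ (by positivity)]
    have h4 : (1 : ℝ) ≤ 4 ^ n := one_le_pow₀ (by norm_num)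
    have hfs : (1 : ℝ) ≤ (n.factorial : ℝ) ^ 2 := one_le_pow₀ hf1
    calc _ ≤ 1 + n * (16 ^ n * (n.factorial : ℝ) ^ 2) := h1
      _ ≤ 16 ^ n * (4 ^ n * (n.factorial : ℝ) ^ 2)
          + 4 ^ n * (16 ^ n * (n.factorial : ℝ) ^ 2) := by
          gcongr
          exact one_le_mul_of_one_le_of_one_le hone (one_le_mul_of_one_le_of_one_le h4 hfs)
      _ = _ := by ring
  calc _ ≤ ∫ ω, (16 ^ n * (A ω ^ 12 + B ω ^ 12 + D ω ^ 12)
          + (16 ^ n)⁻¹ * (L.map fun i => T i ω).prod ^ 4) ∂μ :=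
        integral_mono ((((hA.mul hB).mul hD).mul hG).integrable_pow 2) (hi1.add hi2) hpt
    _ = 16 ^ n * (∫ ω, A ω ^ 12 ∂μ + ∫ ω, B ω ^ 12 ∂μ + ∫ ω, D ω ^ 12 ∂μ)
          + (16 ^ n)⁻¹ * ∫ ω, (L.map fun i => T i ω).prod ^ 4 ∂μ := by
        rw [integral_add hi1 hi2, integral_const_mul, integral_const_mul, integral_add
          hi12 (hD.integrable_pow 12),
          integral_add (hA.integrable_pow 12) (hB.integrable_pow 12)]
    _ ≤ 16 ^ n * (K + K + K) + 2 * (2 ^ n * n.factorial) ^ 2 := by gcongr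
    _ ≤ 12 * K * (2 ^ n * n.factorial) ^ 2 + 2 * (2 ^ n * n.factorial) ^ 2 := by
        have := mul_le_mul_of_nonneg_left (four_pow_le_factorial_sq n)
          (by positivity : 0 ≤ 3 * K * 4 ^ n)
        rw [hsq, h16]
        linarith
    _ = _ := by ring

end ProductBound

instance (d N : ℕ) : IsProbabilityMeasure (whMeasure d N) := by
  unfold whMeasure; infer_instance

/-- The Gaussian coordinates of the Walsh–Hadamard sample space. -/
def whCoord {d N : ℕ} : (Fin d × Fin N) ⊕ Fin N → WHOmega d N → ℝ
  | .inl p, ω => ω.1 p.1 p.2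
  | .inr v, ω => ω.2 v

lemma measurable_whCoord {d N : ℕ} (k : (Fin d × Fin N) ⊕ Fin N) :
    Measurable (whCoord (d := d) (N := N) k) := by
  rcases k with p | v
  · exact (measurable_pi_apply p.2).comp ((measurable_pi_apply p.1).comp measurable_fst)
  · exact (measurable_pi_apply v).comp measurable_snd

lemma isStdGaussianFamily_whCoord (d N : ℕ) :
    IsStdGaussianFamily (whCoord (d := d) (N := N)) (whMeasure d N) := by
  have hpi : (whMeasure d N).map (fun ω k => whCoord k ω)
      = Measure.pi fun _ : (Fin d × Fin N) ⊕ Fin N => gaussianReal 0 1 := by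
    refine (Measure.pi_eq fun s hs => ?_).symm
    rw [Measure.map_apply (measurable_pi_lambda _ measurable_whCoord)
      (MeasurableSet.univ_pi hs)]
    have : (fun ω k => whCoord k ω) ⁻¹' (Set.univ.pi s)
        = (Set.univ.pi fun i : Fin d => Set.univ.pi fun v : Fin N => s (.inl (i, v))) ×ˢ
          (Set.univ.pi fun v : Fin N => s (.inr v)) := by
      ext ω
      simp [Set.mem_pi, whCoord]
    rw [this, whMeasure, Measure.prod_prod]
    simp_rw [Measure.pi_pi]
    rw [Fintype.prod_sum_type, Fintype.prod_prod_type]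
  have hlaw (k) : (whMeasure d N).map (whCoord k) = gaussianReal 0 1 := by
    have := (measurePreserving_eval (fun _ : (Fin d × Fin N) ⊕ Fin N => gaussianReal 0 1) k).map_eq
    rw [← hpi, Measure.map_map (measurable_pi_apply k)
      (measurable_pi_lambda _ measurable_whCoord)] at this
    exact this
  refine ⟨?_, measurable_whCoord, hlaw⟩
  rw [iIndepFun_iff_map_fun_eq_pi_map fun k => (measurable_whCoord k).aemeasurable, hpi]
  simp_rw [hlaw]

/-- A universal bound for the low moments of the block variables. -/
def blockMomentConst : ℝ := 3 * ∫ x, (1 + x ^ 2) ^ 36 ∂(gaussianReal 0 1)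

lemma hasMoments_id_gaussianReal : HasMoments (gaussianReal 0 1) (fun x => x) :=
  fun p => memLp_id_gaussianReal p

lemma integrable_one_add_sq_pow_gaussianReal (n : ℕ) :
    Integrable (fun x : ℝ => (1 + x ^ 2) ^ n) (gaussianReal 0 1) :=
  ((HasMoments.const 1).add (hasMoments_id_gaussianReal.pow 2)).integrable_pow n

lemma one_le_blockMomentConst : 1 ≤ blockMomentConst := by
  have : ∫ _ : ℝ, (1 : ℝ) ∂(gaussianReal 0 1) ≤ ∫ x, (1 + x ^ 2) ^ 36 ∂(gaussianReal 0 1) :=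
    integral_mono (integrable_const _) (integrable_one_add_sq_pow_gaussianReal 36)
      fun x => one_le_pow₀ (by nlinarith [sq_nonneg x])
  simp only [integral_const, probReal_univ, smul_eq_mul, mul_one] at this
  unfold blockMomentConst
  linarith

/-- A universal bound for the twelfth moments of normalised block sums. -/
def blockSumConst : ℝ := (2 ^ 12 * blockMomentConst) ^ 12

lemma le_blockSumConst : 46080 ≤ blockSumConst := by
  unfold blockSumConst
  calc (46080 : ℝ) ≤ (2 ^ 12 * 1) ^ 12 := by norm_num
    _ ≤ _ := by gcongr; exact one_le_blockMomentConst

section BlockSum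

variable {Ω κ : Type*} {ξ : κ → Ω → ℝ} [DecidableEq κ]

/-- A centred product of two variables, multiplied by a power of a third one. -/
def centredBlock (ξ : κ → Ω → ℝ) (k₁ k₂ k₃ : κ) (p : ℕ) : Ω → ℝ :=
  (ξ k₁ * ξ k₂ - fun _ => if k₁ = k₂ then 1 else 0) * ξ k₃ ^ p

lemma centredBlock_mem_posCone (k₁ k₂ k₃ : κ) (p : ℕ) :
    centredBlock ξ k₁ k₂ k₃ p ∈ posCone ξ := by
  refine mul_mem ?_ (pow_mem (var_mem_posCone _) _)
  split_ifs with h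
  · subst h
    convert sq_sub_one_mem_posCone (ξ := ξ) k₁ using 1
    ext ω; simp [sq]
  · convert mul_mem (var_mem_posCone (ξ := ξ) k₁) (var_mem_posCone k₂) using 1
    ext ω; simp

variable [MeasurableSpace Ω] {μ : Measure Ω} [IsProbabilityMeasure μ]

lemma integral_centredBlock_zero (h : IsStdGaussianFamily ξ μ) (k₁ k₂ k₃ : κ) :
    ∫ ω, centredBlock ξ k₁ k₂ k₃ 0 ω ∂μ = 0 := by
  have e : centredBlock ξ k₁ k₂ k₃ 0 = ξ k₁ * ξ k₂ - fun _ => if k₁ = k₂ then 1 else 0 := by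
    simp [centredBlock]
  rw [e]
  simp only [Pi.sub_apply, Pi.mul_apply]
  have hi : Integrable (fun ω => ξ k₁ ω * ξ k₂ ω) μ :=
    ((h.hasMoments k₁).mul (h.hasMoments k₂)).integrable
  rw [integral_sub hi (integrable_const _)]
  split_ifs with hk
  · subst hk
    have h1 := h.integral_comp k₁ (f := fun x => x ^ 2) (by fun_prop)
    have h2 := integral_pow_succ_succ_gaussianReal 0
    have h3 : ∫ ω, ξ k₁ ω * ξ k₁ ω ∂μ = 1 := by
      simp only [← sq]
      rw [h1]
      simpa using h2
    simp [h3]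
  · have h1 := (h.indep.indepFun hk).integral_fun_mul_eq_mul_integral
      (h.meas k₁).aestronglyMeasurable (h.meas k₂).aestronglyMeasurable
    have h2 := h.integral_comp k₁ (f := fun x => x) (by fun_prop)
    rw [h1, h2]
    simp

lemma integral_centredBlock (h : IsStdGaussianFamily ξ μ) {k₁ k₂ k₃ : κ} {p : ℕ}
    (hk : p = 0 ∨ (k₁ ≠ k₃ ∧ k₂ ≠ k₃)) : ∫ ω, centredBlock ξ k₁ k₂ k₃ p ω ∂μ = 0 := by
  rcases hk with rfl | ⟨h13, h23⟩
  · exact integral_centredBlock_zero h _ _ _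
  have hind := (h.indep.indepFun_prodMk h.meas k₁ k₂ k₃ h13 h23).comp
    (φ := fun x : ℝ × ℝ => x.1 * x.2 - if k₁ = k₂ then 1 else 0) (ψ := fun x : ℝ => x ^ p)
    (by fun_prop) (by fun_prop)
  have h1 := h.meas k₁
  have h2 := h.meas k₂
  have h3 := h.meas k₃
  have := hind.integral_fun_mul_eq_mul_integral
    (Measurable.aestronglyMeasurable (by fun_prop)) (Measurable.aestronglyMeasurable (by fun_prop))
  have h0 := integral_centredBlock_zero h k₁ k₂ k₃
  simp only [Function.comp_apply, centredBlock, Pi.mul_apply, Pi.sub_apply, Pi.pow_apply,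
    Pi.one_apply, pow_zero, mul_one] at this h0 ⊢
  rw [this, h0, zero_mul]

lemma integral_centredBlock_pow_le (h : IsStdGaussianFamily ξ μ) (k₁ k₂ k₃ : κ) {p j : ℕ}
    (hp : p ≤ 2) (hj : j ≤ 12) :
    ∫ ω, centredBlock ξ k₁ k₂ k₃ p ω ^ j ∂μ ≤ blockMomentConst := by
  have hi (k) : Integrable (fun ω => (1 + ξ k ω ^ 2) ^ 36) μ :=
    ((HasMoments.const 1).add ((h.hasMoments k).pow 2)).integrable_pow 36
  have hval (k) : ∫ ω, (1 + ξ k ω ^ 2) ^ 36 ∂μ = ∫ x, (1 + x ^ 2) ^ 36 ∂(gaussianReal 0 1) :=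
    h.integral_comp k (f := fun x => (1 + x ^ 2) ^ 36) (by fun_prop)
  have hi12 : Integrable (fun ω => (1 + ξ k₁ ω ^ 2) ^ 36 + (1 + ξ k₂ ω ^ 2) ^ 36) μ :=
    (hi k₁).add (hi k₂)
  calc _ ≤ ∫ ω, ((1 + ξ k₁ ω ^ 2) ^ 36 + (1 + ξ k₂ ω ^ 2) ^ 36 + (1 + ξ k₃ ω ^ 2) ^ 36) ∂μ := by
        refine integral_mono
          ((h.hasMoments_of_mem (centredBlock_mem_posCone k₁ k₂ k₃ p)).integrable_pow j)
          (hi12.add (hi k₃)) fun ω => ?_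
        simp only [centredBlock, Pi.mul_apply, Pi.sub_apply, Pi.pow_apply]
        set a := ξ k₁ ω
        set b := ξ k₂ ω
        set c := ξ k₃ ω
        set δ : ℝ := if k₁ = k₂ then 1 else 0 with hδ
        have hδ1 : 0 ≤ δ ∧ δ ≤ 1 := by rw [hδ]; split_ifs <;> norm_num
        have h1 : |a * b - δ| ≤ (1 + a ^ 2) * (1 + b ^ 2) := by
          rw [abs_le]
          constructor <;> nlinarith [sq_nonneg (a - b), sq_nonneg (a + b), sq_nonneg (a * b)]
        have h2 : |c ^ p| ≤ 1 + c ^ 2 := by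
          interval_cases p
          · simp; positivity
          · rw [abs_le]; constructor <;> nlinarith [sq_nonneg (c - 1), sq_nonneg (c + 1)]
          · rw [abs_of_nonneg (sq_nonneg c)]; linarith
        have hD : 1 ≤ (1 + a ^ 2) * (1 + b ^ 2) * (1 + c ^ 2) := by
          refine one_le_mul_of_one_le_of_one_le (one_le_mul_of_one_le_of_one_le ?_ ?_) ?_ <;>
            nlinarith [sq_nonneg a, sq_nonneg b, sq_nonneg c]
        calc ((a * b - δ) * c ^ p) ^ j ≤ |(a * b - δ) * c ^ p| ^ j := by
              rw [← abs_pow]; exact le_abs_self _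
          _ ≤ ((1 + a ^ 2) * (1 + b ^ 2) * (1 + c ^ 2)) ^ j := by
              rw [abs_mul]; gcongr
          _ ≤ ((1 + a ^ 2) * (1 + b ^ 2) * (1 + c ^ 2)) ^ 12 := pow_le_pow_right₀ hD hj
          _ = (1 + a ^ 2) ^ 12 * (1 + b ^ 2) ^ 12 * (1 + c ^ 2) ^ 12 := by
              rw [mul_pow, mul_pow]
          _ ≤ ((1 + a ^ 2) ^ 12) ^ 3 + ((1 + b ^ 2) ^ 12) ^ 3 + ((1 + c ^ 2) ^ 12) ^ 3 :=
              mul_mul_le_sum_cubes (by positivity) (by positivity) (by positivity)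
          _ = _ := by simp only [← pow_mul]
    _ = blockMomentConst := by
        rw [integral_add hi12 (hi k₃), integral_add (hi k₁) (hi k₂), hval, hval, hval,
          blockMomentConst]
        ring

lemma integral_normalized_block_sum_le [Fintype κ] (h : IsStdGaussianFamily ξ μ) {N : ℕ}
    (hN : 1 ≤ N) (lab : κ → Fin N) {e₁ e₂ e₃ : Fin N → κ} (h₁ : ∀ v, lab (e₁ v) = v)
    (h₂ : ∀ v, lab (e₂ v) = v) (h₃ : ∀ v, lab (e₃ v) = v) {p : ℕ} (hp : p ≤ 2)
    (hk : p = 0 ∨ ∀ v, e₁ v ≠ e₃ v ∧ e₂ v ≠ e₃ v) :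
    ∫ ω, ((Real.sqrt N)⁻¹ * ∑ v, centredBlock ξ (e₁ v) (e₂ v) (e₃ v) p ω) ^ 12 ∂μ
      ≤ blockSumConst := by
  set Y : Fin N → Ω → ℝ := fun v => centredBlock ξ (e₁ v) (e₂ v) (e₃ v) p with hY
  have hcone (v) : Y v ∈ posCone ξ := centredBlock_mem_posCone _ _ _ _
  have hind (s : Finset (Fin N)) (a : Fin N) (ha : a ∉ s) : IndepFun (Y a) (∑ v ∈ s, Y v) μ := by
    have hdisj : Disjoint (Finset.univ.filter fun k => lab k = a)
        (Finset.univ.filter fun k => lab k ∈ s) := by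
      refine Finset.disjoint_left.2 fun k hk hk' => ha ?_
      simp only [Finset.mem_filter] at hk hk'
      exact hk.2 ▸ hk'.2
    set S := Finset.univ.filter fun k => lab k = a
    set T := Finset.univ.filter fun k => lab k ∈ s
    have hS {e : Fin N → κ} (he : ∀ v, lab (e v) = v) : e a ∈ S := by simp [S, he]
    have hT {e : Fin N → κ} (he : ∀ v, lab (e v) = v) (v : s) : e v ∈ T := by simp [T, he]
    have := (h.indep.indepFun_finset S T hdisj h.meas).comp
      (φ := fun x => (x ⟨e₁ a, hS h₁⟩ * x ⟨e₂ a, hS h₂⟩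
        - if e₁ a = e₂ a then 1 else 0) * x ⟨e₃ a, hS h₃⟩ ^ p)
      (ψ := fun x => ∑ v : s, (x ⟨e₁ v, hT h₁ v⟩ * x ⟨e₂ v, hT h₂ v⟩
        - if e₁ v = e₂ v then 1 else 0) * x ⟨e₃ v, hT h₃ v⟩ ^ p)
      (by fun_prop) (by fun_prop)
    convert this using 1
    · rfl
    · ext ω
      rw [Finset.sum_apply, ← Finset.sum_coe_sort]
      rfl
  have hle := integral_sum_pow_le (Q := 12) one_le_blockMomentConst
    (fun v => h.hasMoments_of_mem (hcone v))
    hind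
    (fun v => integral_centredBlock h (hk.imp_right fun hk => hk v))
    (fun s j => by
      have := h.integral_nonneg (pow_mem (sum_mem fun v (_ : v ∈ s) => hcone v) j)
      simpa using this)
    (fun v j hj => integral_centredBlock_pow_le h _ _ _ hp hj) 12 le_rfl Finset.univ
  simp_rw [mul_pow]
  rw [integral_const_mul]
  have hN' : (0 : ℝ) < N := by exact_mod_cast hN
  have e : ((Real.sqrt N)⁻¹) ^ 12 = ((N : ℝ) ^ 6)⁻¹ := by
    rw [inv_pow, show 12 = 2 * 6 by norm_num, pow_mul, Real.sq_sqrt hN'.le]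
  rw [e, inv_mul_le_iff₀ (by positivity)]
  refine hle.trans (le_of_eq ?_)
  simp [blockSumConst, mul_comm]

end BlockSum

section Features

variable {d N : ℕ} {C : ℝ} {H : Matrix (Fin N) (Fin N) ℝ}

/-- The normalised sum of the entries of `Δ^i`. -/
def whSum (i : Fin d) (ω : WHOmega d N) : ℝ :=
  (Real.sqrt N)⁻¹ * ∑ v, whCoord (.inl (i, v)) ω

/-- A factor with controlled twelfth moment, lying in the cone of positive combinations. -/
def IsSpecial (B : WHOmega d N → ℝ) : Prop :=
  B ∈ posCone whCoord ∧ ∫ ω, B ω ^ 12 ∂(whMeasure d N) ≤ blockSumConst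

lemma isSpecial_one : IsSpecial (1 : WHOmega d N → ℝ) := by
  refine ⟨one_mem _, ?_⟩
  simp only [Pi.one_apply, one_pow, integral_const, probReal_univ, smul_eq_mul, mul_one]
  linarith [le_blockSumConst]

lemma mul_sum_mem_posCone {f : Fin N → WHOmega d N → ℝ} (hf : ∀ v, f v ∈ posCone whCoord) :
    (fun ω => (Real.sqrt N)⁻¹ * ∑ v, f v ω) ∈ posCone (whCoord (d := d)) := by
  convert mul_mem (const_mem_posCone (ξ := whCoord (d := d) (N := N))
    (c := (Real.sqrt N)⁻¹) (by positivity)) (sum_mem fun v (_ : v ∈ Finset.univ) => hf v) using 1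
  ext ω
  simp

lemma whSum_mem_posCone (i : Fin d) : whSum (N := N) i ∈ posCone whCoord :=
  mul_sum_mem_posCone fun _ => var_mem_posCone _

lemma isSpecial_block (hN : 1 ≤ N) {e₁ e₂ : Fin N → (Fin d × Fin N) ⊕ Fin N}
    (h₁ : ∀ v, Sum.elim Prod.snd id (e₁ v) = v) (h₂ : ∀ v, Sum.elim Prod.snd id (e₂ v) = v)
    {p : ℕ} (hp : p ≤ 2) (hk : p = 0 ∨ ∀ v, e₁ v ≠ .inr v ∧ e₂ v ≠ .inr v) :
    IsSpecial fun ω : WHOmega d N =>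
      (Real.sqrt N)⁻¹ * ∑ v, centredBlock whCoord (e₁ v) (e₂ v) (.inr v) p ω :=
  ⟨mul_sum_mem_posCone fun _ => centredBlock_mem_posCone _ _ _ _,
    integral_normalized_block_sum_le (isStdGaussianFamily_whCoord d N) hN
      (Sum.elim Prod.snd id) h₁ h₂ (fun _ => rfl) hp hk⟩

lemma isSpecial_initial_sum (hN : 1 ≤ N) :
    IsSpecial fun ω : WHOmega d N => (Real.sqrt N)⁻¹ * ∑ v, whCoord (.inr v) ω := by
  refine ⟨mul_sum_mem_posCone fun _ => var_mem_posCone _, ?_⟩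
  rw [(isStdGaussianFamily_whCoord d N).integral_normalized_sum_pow hN Sum.inr_injective]
  refine (integral_pow_two_mul_gaussianReal_le 6).trans (le_trans ?_ le_blockSumConst)
  norm_num [Nat.factorial]

lemma whFeature_nil (ω : WHOmega d N) (γ : Fin N) : whFeature H [] ω γ = whCoord (.inr γ) ω := by
  simp [whFeature, wordProd, whCoord]

lemma whFeature_cons (i : Fin d) (I : List (Fin d)) (ω : WHOmega d N) :
    whFeature H (i :: I) ω
      = (Real.sqrt N)⁻¹ • H *ᵥ fun v => whCoord (.inl (i, v)) ω * whFeature H I ω v := by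
  simp only [whFeature, wordProd, List.map_cons, List.prod_cons]
  rw [← Matrix.mulVec_mulVec, whA, Matrix.smul_mulVec, ← Matrix.mulVec_mulVec]
  congr 2
  ext v
  rw [Matrix.mulVec_diagonal]
  rfl

/-- A coordinate of the feature of a nonempty word is dominated by a product of normalised sums. -/
lemma whFeature_cons_dominated (hN : 1 ≤ N) (hC : ∀ α β, |H α β| ≤ C) (I : List (Fin d)) :
    ∀ i : Fin d, ∃ (B : WHOmega d N → ℝ) (L : List (Fin d)), IsSpecial B ∧ L.length ≤ I.length ∧
      ∀ γ, Dominated whCoord (fun ω => whFeature H (i :: I) ω γ)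
        (fun ω => C ^ (I.length + 1) * B ω * (L.map fun i => whSum i ω).prod) := by
  have step {i : Fin d} {I : List (Fin d)} {g : Fin N → WHOmega d N → ℝ}
      (hg : ∀ v, Dominated whCoord (fun ω => whFeature H I ω v) (g v)) (γ : Fin N) :
      Dominated whCoord (fun ω => whFeature H (i :: I) ω γ)
        (∑ v, (fun _ => C * (Real.sqrt N)⁻¹) * whCoord (.inl (i, v)) * g v) := by
    have h1 := Dominated.sum Finset.univ fun v (_ : v ∈ Finset.univ) =>
      (((Dominated.const (ξ := whCoord (d := d) (N := N))
        (c := H γ v * (Real.sqrt N)⁻¹) (C := C * (Real.sqrt N)⁻¹) (by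
          rw [abs_mul, abs_of_nonneg (by positivity : 0 ≤ (Real.sqrt N)⁻¹)]
          gcongr
          exact hC γ v)).mul (.of_mem (var_mem_posCone (.inl (i, v))))).mul (hg v))
    convert h1 using 1
    ext ω
    rw [whFeature_cons]
    simp only [Pi.smul_apply, Matrix.mulVec, dotProduct, smul_eq_mul, Finset.mul_sum,
      Finset.sum_apply, Pi.mul_apply]
    exact Finset.sum_congr rfl fun v _ => by ring
  induction I with
  | nil =>
    intro i
    refine ⟨_, [], isSpecial_block hN (e₁ := fun v => .inl (i, v)) (e₂ := fun v => .inr v) (p := 0)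
      (fun _ => rfl) (fun _ => rfl) (by norm_num) (Or.inl rfl), le_rfl, fun γ => ?_⟩
    convert step (g := fun v => whCoord (.inr v)) (fun v => ?_) γ using 1
    · ext ω
      simp [centredBlock, Finset.mul_sum]
      exact Finset.sum_congr rfl fun v _ => by ring
    · simp only [whFeature_nil]
      exact .of_mem (var_mem_posCone _)
  | cons j I ih =>
    intro i
    obtain ⟨B, L, hB, hL, hdom⟩ := ih j
    refine ⟨B, i :: L, hB, by simpa using hL, fun γ => ?_⟩
    convert step hdom γ using 1
    ext ω
    simp only [List.length_cons, List.map_cons, List.prod_cons, whSum, Finset.mul_sum,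
      Finset.sum_mul, Finset.sum_apply, Pi.mul_apply]
    exact Finset.sum_congr rfl fun v _ => by ring

lemma whFeature_dominated (hN : 1 ≤ N) (hC : ∀ α β, |H α β| ≤ C) (I : List (Fin d)) :
    ∃ (p : ℕ) (B : WHOmega d N → ℝ) (L : List (Fin d)), p ≤ 1 ∧ IsSpecial B ∧
      L.length ≤ I.length ∧ ∀ γ, Dominated whCoord (fun ω => whFeature H I ω γ)
        (fun ω => whCoord (.inr γ) ω ^ p *
          (C ^ I.length * B ω * (L.map fun i => whSum i ω).prod)) := by
  rcases I with _ | ⟨i, I⟩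
  · refine ⟨1, 1, [], le_rfl, isSpecial_one, le_rfl, fun γ => ?_⟩
    simpa [whFeature_nil] using Dominated.of_mem (var_mem_posCone _)
  · obtain ⟨B, L, hB, hL, hdom⟩ := whFeature_cons_dominated hN hC I i
    exact ⟨0, B, L, by norm_num, hB, hL.trans (by simp), fun γ => by simpa using hdom γ⟩

/-- Domination by a product of three special factors and of at most `n` normalised sums. -/
def IsControlled (C : ℝ) (n : ℕ) (f : WHOmega d N → ℝ) : Prop :=
  ∃ (A B D : WHOmega d N → ℝ) (L : List (Fin d)), IsSpecial A ∧ IsSpecial B ∧ IsSpecial D ∧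
    L.length ≤ n ∧ Dominated whCoord f (fun ω => Real.sqrt N * C ^ n *
      (A ω * B ω * D ω * (L.map fun i => whSum i ω).prod))

lemma IsControlled.bound (hN : 1 ≤ N) {n : ℕ} {f : WHOmega d N → ℝ} (hf : IsControlled C n f) :
    HasMoments (whMeasure d N) f ∧ ∫ ω, f ω ^ 2 ∂(whMeasure d N)
      ≤ (12 * blockSumConst + 2) * N * (C ^ n * (2 ^ n * n.factorial)) ^ 2 := by
  obtain ⟨A, B, D, L, hA, hB, hD, hL, hdom⟩ := hf
  have hξ := isStdGaussianFamily_whCoord d N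
  refine ⟨hdom.hasMoments hξ, (hdom.integral_sq_le hξ).trans ?_⟩
  have key := integral_special_mul_list_prod_sq_le
    (fun i => hξ.hasMoments_of_mem (whSum_mem_posCone i))
    (fun i p => hξ.integral_normalized_sum_pow hN
      (e := fun v => .inl (i, v)) (fun v w h => by simpa using h) p)
    (hξ.hasMoments_of_mem hA.1) (hξ.hasMoments_of_mem hB.1) (hξ.hasMoments_of_mem hD.1)
    hA.2 hB.2 hD.2 L hL
  simp_rw [mul_pow (Real.sqrt N * C ^ n)]
  rw [integral_const_mul, mul_pow, Real.sq_sqrt (by positivity)]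
  calc _ ≤ N * (C ^ n) ^ 2 * ((12 * blockSumConst + 2) * (2 ^ n * n.factorial) ^ 2) := by
        gcongr
    _ = _ := by ring

/-- The unnormalised deviation of the Gram matrix of the features. -/
def whGap (H : Matrix (Fin N) (Fin N) ℝ) (I J : List (Fin d)) (ω : WHOmega d N) : ℝ :=
  whFeature H I ω ⬝ᵥ whFeature H J ω - N * wordDelta I J

lemma whGap_comm (I J : List (Fin d)) : whGap H I J = whGap H J I := by
  ext ω
  simp only [whGap, wordDelta, dotProduct_comm, eq_comm]

/-- The error term in the recursion for `whGap`. -/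
def whGapError (H : Matrix (Fin N) (Fin N) ℝ) (i j : Fin d) (I J : List (Fin d))
    (ω : WHOmega d N) : ℝ :=
  ∑ v, centredBlock whCoord (.inl (i, v)) (.inl (j, v)) (.inr v) 0 ω *
    (whFeature H I ω v * whFeature H J ω v)

lemma whGap_cons_cons (hN : 1 ≤ N) (hH : H * Hᵀ = (N : ℝ) • (1 : Matrix (Fin N) (Fin N) ℝ))
    (i j : Fin d) (I J : List (Fin d)) :
    whGap H (i :: I) (j :: J)
      = (if i = j then whGap H I J else 0) + whGapError H i j I J := by
  have hN' : (0 : ℝ) < N := by exact_mod_cast hN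
  have hH' : Hᵀ * H = (N : ℝ) • (1 : Matrix (Fin N) (Fin N) ℝ) := by
    have h1 : H * ((N : ℝ)⁻¹ • Hᵀ) = 1 := by
      rw [Matrix.mul_smul, hH, smul_smul, inv_mul_cancel₀ hN'.ne', one_smul]
    have h2 := mul_eq_one_comm.1 h1
    rw [Matrix.smul_mul] at h2
    rw [← h2, smul_smul, mul_inv_cancel₀ hN'.ne', one_smul]
  ext ω
  have hdot (x y : Fin N → ℝ) :
      ((Real.sqrt N)⁻¹ • H *ᵥ x) ⬝ᵥ ((Real.sqrt N)⁻¹ • H *ᵥ y) = x ⬝ᵥ y := by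
    have h3 : (H *ᵥ x) ⬝ᵥ (H *ᵥ y) = N * (x ⬝ᵥ y) := by
      rw [Matrix.dotProduct_mulVec, ← Matrix.mulVec_transpose, Matrix.mulVec_mulVec, hH',
        Matrix.smul_mulVec, Matrix.one_mulVec, smul_dotProduct, smul_eq_mul]
    rw [smul_dotProduct, dotProduct_smul, h3, smul_eq_mul, smul_eq_mul, ← mul_assoc, ← mul_inv,
      Real.mul_self_sqrt hN'.le, inv_mul_cancel_left₀ hN'.ne']
  have hcons : whFeature H (i :: I) ω ⬝ᵥ whFeature H (j :: J) ω
      = (if i = j then whFeature H I ω ⬝ᵥ whFeature H J ω else 0) + whGapError H i j I J ω := by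
    rw [whFeature_cons, whFeature_cons, hdot, whGapError]
    by_cases hij : i = j
    · subst hij
      simp only [dotProduct, centredBlock, if_true, ← Finset.sum_add_distrib]
      refine Finset.sum_congr rfl fun v _ => ?_
      simp
      ring
    · simp only [dotProduct, centredBlock, hij, if_false, zero_add]
      refine Finset.sum_congr rfl fun v _ => ?_
      simp [hij]
      ring
  simp only [whGap, Pi.add_apply, hcons]
  by_cases hij : i = j
  · subst hij
    simp only [if_true, wordDelta, List.cons.injEq, true_and, whGap]
    ring
  · simp [hij, wordDelta]

lemma isControlled_whGapError (hN : 1 ≤ N) (hC : ∀ α β, |H α β| ≤ C)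
    (i j : Fin d) (I J : List (Fin d)) :
    IsControlled C (I.length + J.length) (whGapError H i j I J) := by
  obtain ⟨p, B, L, hp, hB, hL, hI⟩ := whFeature_dominated hN hC I
  obtain ⟨q, D, M, hq, hD, hM, hJ⟩ := whFeature_dominated hN hC J
  refine ⟨_, B, D, L ++ M, isSpecial_block hN (e₁ := fun v => .inl (i, v))
    (e₂ := fun v => .inl (j, v)) (p := p + q) (fun _ => rfl) (fun _ => rfl) (by omega)
    (Or.inr (by simp)), hB, hD, by simp; omega, ?_⟩
  have h := Dominated.sum Finset.univ fun v (_ : v ∈ Finset.univ) =>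
    (Dominated.of_mem (centredBlock_mem_posCone (ξ := whCoord) (.inl (i, v)) (.inl (j, v))
      (.inr v) 0)).mul ((hI v).mul (hJ v))
  have hs : Real.sqrt N * (Real.sqrt N)⁻¹ = 1 := mul_inv_cancel₀ (by positivity)
  convert h using 1
  · ext ω
    simp [whGapError]
  · ext ω
    have e (v : Fin N) : centredBlock whCoord (Sum.inl (i, v)) (Sum.inl (j, v)) (Sum.inr v) (p + q) ω
        = centredBlock whCoord (Sum.inl (i, v)) (Sum.inl (j, v)) (Sum.inr v) 0 ω
          * (whCoord (.inr v) ω ^ p * whCoord (.inr v) ω ^ q) := by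
      simp [centredBlock, pow_add]
    simp only [e, Finset.sum_apply, Pi.mul_apply, List.map_append, List.prod_append, pow_add]
    calc _ = (Real.sqrt N * (Real.sqrt N)⁻¹) * (∑ v,
          centredBlock whCoord (Sum.inl (i, v)) (Sum.inl (j, v)) (Sum.inr v) 0 ω
          * (whCoord (.inr v) ω ^ p * whCoord (.inr v) ω ^ q)) *
          (C ^ I.length * C ^ J.length * B ω * D ω * (L.map fun i => whSum i ω).prod
            * (M.map fun i => whSum i ω).prod) := by ring
      _ = _ := by
        rw [hs, one_mul, Finset.sum_mul]
        exact Finset.sum_congr rfl fun v _ => by ring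

lemma isControlled_whGap_nil (hN : 1 ≤ N) (hC : ∀ α β, |H α β| ≤ C) (I : List (Fin d)) :
    IsControlled C I.length (whGap H I []) := by
  have hs : Real.sqrt N * (Real.sqrt N)⁻¹ = 1 := mul_inv_cancel₀ (by positivity)
  rcases I with _ | ⟨i, I⟩
  · refine ⟨_, 1, 1, [], isSpecial_block hN (e₁ := fun v => .inr v) (e₂ := fun v => .inr v)
      (p := 0) (fun _ => rfl) (fun _ => rfl) (by norm_num) (Or.inl rfl), isSpecial_one,
      isSpecial_one, le_rfl, ?_⟩
    convert Dominated.of_mem (sum_mem fun v (_ : v ∈ Finset.univ) =>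
      centredBlock_mem_posCone (ξ := whCoord (d := d) (N := N)) (.inr v) (.inr v) (.inr v) 0)
      using 1
    · ext ω
      simp [whGap, wordDelta, centredBlock, dotProduct, whFeature_nil]
    · ext ω
      simp [← mul_assoc, hs]
  · obtain ⟨B, L, hB, hL, hdom⟩ := whFeature_cons_dominated hN hC I i
    refine ⟨_, B, 1, L, isSpecial_initial_sum hN, hB, isSpecial_one, hL.trans (by simp), ?_⟩
    convert Dominated.sum Finset.univ fun v (_ : v ∈ Finset.univ) =>
      (Dominated.of_mem (var_mem_posCone (.inr v))).mul (hdom v) using 1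
    · ext ω
      simp [whGap, wordDelta, dotProduct, whFeature_nil, mul_comm]
    · ext ω
      simp only [Finset.sum_apply, Pi.mul_apply, Pi.one_apply, List.length_cons]
      rw [← Finset.sum_mul]
      calc _ = (Real.sqrt N * (Real.sqrt N)⁻¹) * ((∑ v, whCoord (.inr v) ω) *
          (C ^ (I.length + 1) * B ω * (L.map fun i => whSum i ω).prod)) := by ring
        _ = _ := by rw [hs, one_mul]

lemma whGap_bound (hN : 1 ≤ N) (hC1 : 1 ≤ C)
    (hH : H * Hᵀ = (N : ℝ) • (1 : Matrix (Fin N) (Fin N) ℝ)) (hC : ∀ α β, |H α β| ≤ C)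
    (I : List (Fin d)) : ∀ J : List (Fin d),
    HasMoments (whMeasure d N) (whGap H I J) ∧
      ∫ ω, whGap H I J ω ^ 2 ∂(whMeasure d N) ≤ (12 * blockSumConst + 2) * N *
        (C ^ (I.length + J.length) * (2 ^ (I.length + J.length) *
          (I.length + J.length).factorial)) ^ 2 := by
  induction I with
  | nil =>
    intro J
    rw [whGap_comm]
    simpa using (isControlled_whGap_nil hN hC J).bound hN
  | cons i I ih =>
    intro J
    rcases J with _ | ⟨j, J⟩
    · exact (isControlled_whGap_nil hN hC _).bound hN
    obtain ⟨hm, hb⟩ := ih J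
    obtain ⟨hm', hb'⟩ := (isControlled_whGapError hN hC i j I J).bound hN
    rw [whGap_cons_cons hN hH]
    set n := I.length + J.length with hn
    have hlen : (i :: I).length + (j :: J).length = n + 2 := by simp; omega
    rw [hlen]
    set W := C ^ n * ((2 : ℝ) ^ n * n.factorial) with hW
    set c := 12 * blockSumConst + 2
    have hc : 0 ≤ c := by linarith [le_blockSumConst]
    obtain ⟨hg, hgb⟩ : HasMoments (whMeasure d N) (if i = j then whGap H I J else 0) ∧
        ∫ ω, (if i = j then whGap H I J else 0) ω ^ 2 ∂(whMeasure d N) ≤ c * N * W ^ 2 := by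
      split_ifs
      · exact ⟨hm, hb⟩
      · refine ⟨.const 0, ?_⟩
        simp only [Pi.zero_apply, ne_eq, OfNat.ofNat_ne_zero, not_false_eq_true, zero_pow,
          integral_zero]
        positivity
    refine ⟨hg.add hm', ?_⟩
    set g := if i = j then whGap H I J else 0
    have hW0 : 0 ≤ W := by positivity
    have hWle : 2 * W ≤ C ^ (n + 2) * (2 ^ (n + 2) * ((n + 2).factorial : ℝ)) := by
      have h1 : C ^ n ≤ C ^ (n + 2) := pow_le_pow_right₀ hC1 (by omega)
      have h2 : (n.factorial : ℝ) ≤ (n + 2).factorial := by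
        exact_mod_cast Nat.factorial_le (by omega)
      calc 2 * W = C ^ n * (2 * 2 ^ n * n.factorial) := by rw [hW]; ring
        _ ≤ C ^ (n + 2) * (2 ^ (n + 2) * ((n + 2).factorial : ℝ)) := by
          gcongr
          rw [← pow_succ']
          exact pow_le_pow_right₀ (by norm_num) (by omega)
    have hig := (hg.integrable_pow 2).const_mul 2
    have hie := (hm'.integrable_pow 2).const_mul 2
    calc ∫ ω, (g + whGapError H i j I J) ω ^ 2 ∂(whMeasure d N)
        ≤ ∫ ω, (2 * g ω ^ 2 + 2 * whGapError H i j I J ω ^ 2) ∂(whMeasure d N) :=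
          integral_mono ((hg.add hm').integrable_pow 2) (hig.add hie) fun ω => by
            simp only [Pi.add_apply]
            nlinarith [sq_nonneg (g ω - whGapError H i j I J ω)]
      _ = 2 * ∫ ω, g ω ^ 2 ∂(whMeasure d N)
          + 2 * ∫ ω, whGapError H i j I J ω ^ 2 ∂(whMeasure d N) := by
          rw [integral_add hig hie, integral_const_mul, integral_const_mul]
      _ ≤ 2 * (c * N * W ^ 2) + 2 * (c * N * W ^ 2) := by gcongr
      _ = c * N * (2 * W) ^ 2 := by ring
      _ ≤ _ := by gcongr

end Features

lemma monotone_doubleFactorial : Monotone Nat.doubleFactorial := by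
  have h : ∀ n, Nat.doubleFactorial n ≤ Nat.doubleFactorial (n + 1) := by
    intro n
    induction n using Nat.twoStepInduction with
    | zero => simp
    | one => simp [Nat.doubleFactorial]
    | more n ih _ =>
      rw [Nat.doubleFactorial_add_two, show n + 2 + 1 = (n + 1) + 2 by ring,
        Nat.doubleFactorial_add_two]
      exact Nat.mul_le_mul (by omega) ih
  exact monotone_nat_of_le_succ h

lemma pow_mul_factorial_le_doubleFactorial {k : ℕ} (hk : 2 ≤ k) (n : ℕ) :
    k ^ n * n.factorial ≤ Nat.doubleFactorial (k * n) := by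
  induction n with
  | zero => simp
  | succ n ih =>
    obtain ⟨m, hm⟩ := Nat.exists_eq_add_of_le' hk
    have e : k * (n + 1) = (k * n + m) + 2 := by rw [mul_add, mul_one]; omega
    calc k ^ (n + 1) * (n + 1).factorial = (k * (n + 1)) * (k ^ n * n.factorial) := by
          rw [Nat.factorial_succ]; ring
      _ ≤ (k * (n + 1)) * Nat.doubleFactorial (k * n + m) :=
          Nat.mul_le_mul_left _ (ih.trans (monotone_doubleFactorial (Nat.le_add_right _ _)))
      _ = _ := by rw [e, Nat.doubleFactorial_add_two]

/-- **Key moment bound for the Walsh–Hadamard model.**  There is a universal constant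
`c > 0` such that, setting `κ = ⌈2C⁴⌉`, for all `d, N ≥ 1`, every `H ∈ ℝ^{N×N}` with
`H Hᵀ = N⬝I_N` and entries bounded in absolute value by `C`, and all words `I, J`
over `{1,…,d}`,
`E[((1/N)⟨A_I h₀, A_J h₀⟩ - δ_{I,J})²]^{1/2} ≤ (κ(|I|+|J|))!! ⬝ c / √N`. -/
theorem walsh_hadamard_moment_bound :
    ∃ c : ℝ, 0 < c ∧
      ∀ (C : ℝ), 1 ≤ C →
        ∀ (d N : ℕ), 1 ≤ d → 1 ≤ N →
          ∀ H : Matrix (Fin N) (Fin N) ℝ,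
            H * Hᵀ = (N : ℝ) • (1 : Matrix (Fin N) (Fin N) ℝ) →
            (∀ α β, |H α β| ≤ C) →
            ∀ (I J : List (Fin d)),
              Real.sqrt (∫ ω, (((N : ℕ) : ℝ)⁻¹ *
                    (whFeature H I ω ⬝ᵥ whFeature H J ω) - wordDelta I J) ^ 2
                  ∂(whMeasure d N))
                ≤ (Nat.doubleFactorial (⌈2 * C ^ 4⌉₊ * (I.length + J.length)) : ℝ)
                    * (c / Real.sqrt N) := by
  have hK := le_blockSumConst
  refine ⟨Real.sqrt (12 * blockSumConst + 2), Real.sqrt_pos.2 (by linarith), ?_⟩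
  intro C hC1 d N _ hN H hH hC I J
  have hN' : (0 : ℝ) < N := by exact_mod_cast hN
  set n := I.length + J.length with hn
  obtain ⟨-, hb⟩ := whGap_bound hN hC1 hH hC I J
  rw [← hn] at hb
  have e (ω : WHOmega d N) : ((N : ℝ)⁻¹ * (whFeature H I ω ⬝ᵥ whFeature H J ω)
      - wordDelta I J) ^ 2 = ((N : ℝ) ^ 2)⁻¹ * whGap H I J ω ^ 2 := by
    rw [whGap]
    field_simp
  simp_rw [e]
  rw [integral_const_mul]
  set k := ⌈2 * C ^ 4⌉₊
  have hC4 : 1 ≤ C ^ 4 := one_le_pow₀ hC1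
  have hk : 2 * C ^ 4 ≤ k := Nat.le_ceil _
  have hk2 : 2 ≤ k := by
    have : (2 : ℝ) ≤ k := by linarith
    exact_mod_cast this
  have hW : C ^ n * ((2 : ℝ) ^ n * n.factorial) ≤ (Nat.doubleFactorial (k * n) : ℝ) := by
    have h1 : ((k ^ n * n.factorial : ℕ) : ℝ) ≤ (Nat.doubleFactorial (k * n) : ℝ) := by
      exact_mod_cast pow_mul_factorial_le_doubleFactorial hk2 n
    push_cast at h1
    refine le_trans ?_ h1
    rw [← mul_assoc, ← mul_pow]
    gcongr
    have : C ^ 1 ≤ C ^ 4 := pow_le_pow_right₀ hC1 (by norm_num)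
    linarith
  rw [Real.sqrt_le_iff]
  refine ⟨by positivity, ?_⟩
  rw [mul_pow, div_pow, Real.sq_sqrt (by linarith), Real.sq_sqrt hN'.le]
  calc _ ≤ ((N : ℝ) ^ 2)⁻¹ * ((12 * blockSumConst + 2) * N *
        (C ^ n * (2 ^ n * n.factorial)) ^ 2) := by gcongr
    _ = (C ^ n * (2 ^ n * n.factorial)) ^ 2 * ((12 * blockSumConst + 2) / N) := by
        field_simp
    _ ≤ _ := by
        gcongr

end
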